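/- Let G be a group, and let R and R' be unitary representations of G. If there exists a nonzero G-equivariant Hilbert–Schmidt operator f : R → R', then R contains a nonzero finite-dimensional G-invariant closed subspace. -/

import Mathlib

/-- A continuous linear map from a Hilbert space to a Banach space whose squared norms on a Hilbert
basis are summable is compact. -/
theorem isCompactOperator_of_summable_norm_sq {𝕜 E F ι : Type*} [RCLike 𝕜]
    [NormedAddCommGroup E] [InnerProductSpace 𝕜 E]
    [NormedAddCommGroup F] [NormedSpace 𝕜 F] [CompleteSpace F]
    (b : HilbertBasis ι 𝕜 E) (f : E →L[𝕜] F) (hf : Summable fun i => ‖f (b i)‖ ^ 2) :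
    IsCompactOperator f := by
  classical
  set A : ι → E →L[𝕜] F := fun i => (innerSL 𝕜 (b i)).smulRight (f (b i)) with hA
  have hAc (i : ι) : A i ∈ compactOperator (RingHom.id 𝕜) E F :=
    IsCompactOperator.clm_comp (f := innerSL 𝕜 (b i))
      (isCompactOperator_of_locallyCompactSpace_dom (innerSL 𝕜 (b i)))
      (ContinuousLinearMap.toSpanSingleton 𝕜 (f (b i)))
  have hbound (t : Finset ι) (v : E) :
      ‖∑ i ∈ t, A i v‖ ≤ √(∑ i ∈ t, ‖f (b i)‖ ^ 2) * ‖v‖ := calc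
    ‖∑ i ∈ t, A i v‖ ≤ ∑ i ∈ t, ‖inner 𝕜 (b i) v‖ * ‖f (b i)‖ :=
      (norm_sum_le _ _).trans_eq (by simp [hA, norm_smul])
    _ ≤ √(∑ i ∈ t, ‖inner 𝕜 (b i) v‖ ^ 2) * √(∑ i ∈ t, ‖f (b i)‖ ^ 2) :=
      Real.sum_mul_le_sqrt_mul_sqrt _ _ _
    _ ≤ ‖v‖ * √(∑ i ∈ t, ‖f (b i)‖ ^ 2) := by
      gcongr
      exact Real.sqrt_le_iff.2 ⟨norm_nonneg v, b.orthonormal.sum_inner_products_le v⟩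
    _ = _ := mul_comm _ _
  have hsum (v : E) : HasSum (fun i => A i v) (f v) := by
    simpa [hA, b.repr_apply_apply] using (b.hasSum_repr v).mapL f
  have hclosed : IsClosed {g : E →L[𝕜] F | IsCompactOperator g} :=
    isClosed_setOfPred_isCompactOperator
  refine hclosed.closure_subset (Metric.mem_closure_iff.2 fun ε hε => ?_)
  obtain ⟨s, hs⟩ := summable_iff_vanishing_norm.1 hf ((ε / 2) ^ 2) (by positivity)
  refine ⟨∑ i ∈ s, A i, Submodule.sum_mem _ fun i _ => hAc i, ?_⟩
  rw [dist_eq_norm]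
  refine (ContinuousLinearMap.opNorm_le_bound _ (half_pos hε).le fun v => ?_).trans_lt
    (half_lt_self hε)
  rw [sub_apply, sum_apply]
  refine le_of_tendsto ((hsum v).sub_const (∑ i ∈ s, A i v)).norm ?_
  filter_upwards [Filter.eventually_ge_atTop s] with t hst
  rw [← Finset.sum_sdiff_eq_sub hst]
  refine (hbound _ v).trans ?_
  gcongr
  refine Real.sqrt_le_iff.2 ⟨(half_pos hε).le, ?_⟩
  exact (le_abs_self _).trans (hs (t \ s) Finset.sdiff_disjoint).le

/-- If `f` intertwines unitary operators `U` and `U'`, then `f† ∘ f` commutes with `U`. -/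
theorem adjoint_comp_self_apply_of_intertwines {𝕜 E F : Type*} [RCLike 𝕜]
    [NormedAddCommGroup E] [InnerProductSpace 𝕜 E] [CompleteSpace E]
    [NormedAddCommGroup F] [InnerProductSpace 𝕜 F] [CompleteSpace F]
    (f : E →L[𝕜] F) (U : E ≃ₗᵢ[𝕜] E) (U' : F ≃ₗᵢ[𝕜] F) (h : ∀ v, f (U v) = U' (f v)) (v : E) :
    (ContinuousLinearMap.adjoint f ∘L f) (U v) = U ((ContinuousLinearMap.adjoint f ∘L f) v) := by
  refine ext_inner_left 𝕜 fun w => ?_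
  obtain ⟨w, rfl⟩ := U.surjective w
  simp [ContinuousLinearMap.adjoint_inner_right, h]

/-- Let `G` be a group and `R`, `R'` unitary representations of
`G` on Hilbert spaces.  If there is a nonzero `G`-equivariant Hilbert–Schmidt
operator `f : R → R'` (i.e. `Σ_i ‖f(b_i)‖² < ∞` for some Hilbert basis
`(b_i)` of `R`), then `R` contains a nonzero finite-dimensional `G`-invariant
closed subspace. -/
theorem stmt_1 {G R R' : Type} [Group G]
    [NormedAddCommGroup R] [InnerProductSpace ℂ R] [CompleteSpace R]
    [NormedAddCommGroup R'] [InnerProductSpace ℂ R'] [CompleteSpace R']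
    (ρ : G →* (R ≃ₗᵢ[ℂ] R)) (ρ' : G →* (R' ≃ₗᵢ[ℂ] R'))
    (f : R →L[ℂ] R') (hf0 : f ≠ 0)
    (hequiv : ∀ (g : G) (v : R), f (ρ g v) = ρ' g (f v))
    (hHS : ∃ (ι : Type) (b : HilbertBasis ι ℂ R),
      Summable fun i : ι => ‖f (b i)‖ ^ 2) :
    ∃ K : Submodule ℂ R, IsClosed (K : Set R) ∧ K ≠ ⊥ ∧
      FiniteDimensional ℂ K ∧ ∀ g : G, ∀ v ∈ K, ρ g v ∈ K := by
  obtain ⟨ι, b, hb⟩ := hHS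
  set T : R →L[ℂ] R := ContinuousLinearMap.adjoint f ∘L f with hT
  have hcomp : IsCompactOperator T :=
    (isCompactOperator_of_summable_norm_sq b f hb).clm_comp (ContinuousLinearMap.adjoint f)
  have hsymm : T.IsSymmetric := (ContinuousLinearMap.isPositive_adjoint_comp_self f).isSymmetric
  have hT0 : T ≠ 0 := by
    intro h
    refine hf0 (ContinuousLinearMap.ext fun v => ?_)
    have hv := ContinuousLinearMap.apply_norm_sq_eq_inner_adjoint_left f v
    rw [← hT, h] at hv
    simpa using hv
  have hex : ∃ μ, Module.End.HasEigenvalue (T : Module.End ℂ R) μ ∧ μ ≠ 0 := by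
    by_contra! h
    exact hT0 ((ContinuousLinearMap.eq_zero_of_forall_hasEigenvalue_eq_zero hcomp hsymm).1 h)
  obtain ⟨μ, hμ, hμ0⟩ := hex
  have hfin := ContinuousLinearMap.finite_dimensional_eigenspace hcomp μ hμ0
  refine ⟨Module.End.eigenspace (T : Module.End ℂ R) μ,
    Submodule.closed_of_finiteDimensional _, hμ, hfin, fun g v hv => ?_⟩
  rw [Module.End.mem_eigenspace_iff] at hv ⊢
  have hv' : T v = μ • v := hv
  change T (ρ g v) = μ • ρ g v
  rw [hT, adjoint_comp_self_apply_of_intertwines f (ρ g) (ρ' g) (hequiv g), ← hT, hv', map_smul]
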